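/- arXiv:2511.21144 — 2 statements merged into one kernel-verified Lean document; each statement's English description precedes it below -/
import Mathlib

section
/- Let k ≥ 3 be an integer, let g = 2t ≥ 4 be an even integer, and let d be an integer with t ≤ d ≤ g. If a finite k-regular simple graph with girth exactly g and diameter exactly d has exactly M(k,g) + 2·max{M_0(k, 2d−2t−1), M_1(k, 2d−2t−1)} vertices, then it is bipartite. -/
/-- The Moore bound `M(k,g)`, with the convention `M(k,g) = 0` for `g ≤ 0`. -/
def mooreBound (k : ℕ) (g : ℤ) : ℕ :=
  if g ≤ 0 then 0
  else if g % 2 = 1 then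
    1 + k * ∑ i ∈ Finset.range ((g - 1) / 2).toNat, (k - 1) ^ i
  else
    2 * ∑ i ∈ Finset.range (g / 2).toNat, (k - 1) ^ i

/-- `M₀(k,m)` for odd `m = 2τ+1 ≥ 1` is `1 + k·∑_{i=0}^{⌊(τ−2)/2⌋}(k−1)^{2i+1}`,
with the convention `M₀(k,m) = 0` for `m ≤ 0`. -/
def mooreBound0 (k : ℕ) (m : ℤ) : ℕ :=
  if m ≤ 0 then 0
  else 1 + k * ∑ i ∈ Finset.range (((m - 1) / 2 - 2) / 2 + 1).toNat, (k - 1) ^ (2 * i + 1)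

/-- `M₁(k,m)` for odd `m = 2τ+1 ≥ 1` is `k·∑_{i=0}^{⌊(τ−1)/2⌋}(k−1)^{2i}`,
with the convention `M₁(k,m) = 0` for `m ≤ 0`. -/
def mooreBound1 (k : ℕ) (m : ℤ) : ℕ :=
  if m ≤ 0 then 0
  else k * ∑ i ∈ Finset.range (((m - 1) / 2 - 1) / 2 + 1).toNat, (k - 1) ^ (2 * i)

/-- A graph is `k`-regular: every vertex has exactly `k` neighbours. -/
def IsRegular' (k : ℕ) {V : Type*} (G : SimpleGraph V) : Prop :=
  ∀ v : V, (G.neighborSet v).ncard = k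

/-- A `(k; g, d)`-graph: a `k`-regular simple graph of girth exactly `g` and
diameter exactly `d`. -/
def IsKGDGraph (k g d : ℕ) {V : Type*} (G : SimpleGraph V) : Prop :=
  IsRegular' k G ∧ G.egirth = g ∧ G.ediam = d

namespace SimpleGraph

variable {V : Type*} {G : SimpleGraph V}

/-- Two paths with the same ends that are short compared to the girth coincide. -/
theorem Walk.IsPath.eq_of_length_add_length_lt_egirth {u v : V} {p q : G.Walk u v}
    (hp : p.IsPath) (hq : q.IsPath) (hlt : ((p.length + q.length : ℕ) : ℕ∞) < G.egirth) :
    p = q := by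
  classical
  set s : Set (Sym2 V) := {e | e ∈ p.edges ++ q.edges} with hs
  have hsG : fromEdgeSet s ≤ G := by
    intro a b hab
    rw [fromEdgeSet_adj] at hab
    have := hab.1
    simp only [hs, Set.mem_ofPred_eq, List.mem_append] at this
    exact this.elim p.adj_of_mem_edges q.adj_of_mem_edges
  have hmem : ∀ e ∈ p.edges ++ q.edges, e ∈ (fromEdgeSet s).edgeSet := by
    intro e he
    rw [edgeSet_fromEdgeSet]
    refine ⟨he, fun hd => ?_⟩
    have heG : e ∈ G.edgeSet := (List.mem_append.1 he).elim
      (fun h => p.edges_subset_edgeSet h) (fun h => q.edges_subset_edgeSet h)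
    exact G.not_isDiag_of_mem_edgeSet heG hd
  have hpe : ∀ e ∈ p.edges, e ∈ (fromEdgeSet s).edgeSet :=
    fun e he => hmem e (List.mem_append_left _ he)
  have hqe : ∀ e ∈ q.edges, e ∈ (fromEdgeSet s).edgeSet :=
    fun e he => hmem e (List.mem_append_right _ he)
  have hacyc : (fromEdgeSet s).IsAcyclic := by
    intro a c hc
    have hnd := hc.isTrail.edges_nodup
    have hsub : c.edges ⊆ p.edges ++ q.edges := by
      intro e he
      have := c.edges_subset_edgeSet he
      rw [edgeSet_fromEdgeSet] at this
      exact this.1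
    have hle : c.length ≤ p.length + q.length := by
      have := (hnd.subperm hsub).length_le
      simpa using this
    have hg : G.egirth ≤ ((c.mapLe hsG).length : ℕ∞) := egirth_le_length (hc.mapLe hsG)
    rw [Walk.length_mapLe] at hg
    exact absurd (hg.trans (by exact_mod_cast hle)) (not_le.2 hlt)
  have key : (⟨_, hp.transfer hpe⟩ : (fromEdgeSet s).Path u v) = ⟨_, hq.transfer hqe⟩ :=
    (hacyc.subsingleton_path u v).elim _ _
  have key' : p.transfer _ hpe = q.transfer _ hqe := congrArg Subtype.val key
  have hinj := congrArg (Walk.mapLe hsG) key'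
  refine Walk.ext_support ?_
  simpa using congrArg Walk.support hinj

/-- Spheres whose radius is small compared to the girth are independent. -/
theorem Connected.dist_ne_of_adj (hc : G.Connected) {x u w : V} (hadj : G.Adj u w)
    (hlt : ((2 * G.dist x u + 1 : ℕ) : ℕ∞) < G.egirth) : G.dist x u ≠ G.dist x w := by
  classical
  intro heq
  obtain ⟨p, hp, hpl⟩ := hc.exists_path_of_dist x u
  obtain ⟨q, hq, hql⟩ := hc.exists_path_of_dist x w
  have hw : w ∉ p.support := by
    intro hw
    have h1 := p.length_takeUntil_lt_length hw hadj.ne'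
    have h2 := dist_le (p.takeUntil w hw)
    omega
  have := (hp.concat hw hadj).eq_of_length_add_length_lt_egirth hq (by
    rw [Walk.length_concat, hpl, hql, ← heq]
    convert hlt using 2
    omega)
  have := congrArg Walk.length this
  rw [Walk.length_concat] at this
  omega

/-- Below half the girth, every vertex has at most one neighbour closer to the root. -/
theorem Connected.eq_of_adj_of_dist_eq (hc : G.Connected) {x u w v : V} (hu : G.Adj u v)
    (hw : G.Adj w v) (hud : G.dist x v = G.dist x u + 1) (hwd : G.dist x v = G.dist x w + 1)
    (hlt : ((2 * G.dist x v : ℕ) : ℕ∞) < G.egirth) : u = w := by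
  obtain ⟨p, hp, hpl⟩ := hc.exists_path_of_dist x u
  obtain ⟨q, hq, hql⟩ := hc.exists_path_of_dist x w
  have hp' : (p.concat hu).IsPath := Walk.isPath_of_length_eq_dist _ (by simp [hpl, hud])
  have hq' : (q.concat hw).IsPath := Walk.isPath_of_length_eq_dist _ (by simp [hql, hwd])
  have := hp'.eq_of_length_add_length_lt_egirth hq' (by
    rw [Walk.length_concat, Walk.length_concat]
    convert hlt using 2
    omega)
  simpa using congrArg Walk.penultimate this

open Finset Classical in
/-- An independent set containing half of the vertices of a regular graph is one of the two
parts of a bipartition. -/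
theorem colorable_two_of_isIndepSet [Fintype V] {k : ℕ}
    (hreg : G.IsRegularOfDegree k) (s : Finset V) (hs : ∀ u ∈ s, ∀ w ∈ s, ¬ G.Adj u w)
    (hcard : Fintype.card V ≤ 2 * #s) : G.Colorable 2 := by
  have hsum := sum_card_bipartiteAbove_eq_sum_card_bipartiteBelow (s := s) (t := sᶜ) G.Adj
  have hl : ∑ a ∈ s, #(sᶜ.bipartiteAbove G.Adj a) = #s * k := by
    rw [← smul_eq_mul, ← sum_const]
    refine sum_congr rfl fun a ha => ?_
    rw [← hreg a, ← card_neighborFinset_eq_degree]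
    congr 1
    ext b
    simp only [bipartiteAbove, mem_filter, mem_compl, mem_neighborFinset]
    exact ⟨fun h => h.2, fun h => ⟨fun hb => hs a ha b hb h, h⟩⟩
  have hsub : ∀ b, s.bipartiteBelow G.Adj b ⊆ G.neighborFinset b := by
    intro b a ha
    rw [mem_neighborFinset]
    exact (mem_filter.1 ha).2.symm
  have hle : ∀ b ∈ sᶜ, #(s.bipartiteBelow G.Adj b) ≤ k := fun b _ => by
    rw [← hreg b, ← card_neighborFinset_eq_degree]
    exact card_le_card (hsub b)
  have hcompl : ∀ u ∉ s, ∀ w ∉ s, ¬ G.Adj u w := by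
    intro u hu w hw hadj
    have hlt : #(s.bipartiteBelow G.Adj u) < k := by
      rw [← hreg u, ← card_neighborFinset_eq_degree]
      refine card_lt_card ((ssubset_iff_of_subset (hsub u)).2 ⟨w, by simpa using hadj, ?_⟩)
      exact fun h => hw (mem_filter.1 h).1
    have h1 := sum_lt_sum hle ⟨u, by simpa using hu, hlt⟩
    rw [← hsum, hl, sum_const, smul_eq_mul] at h1
    have h2 := card_add_card_compl s
    have h3 := lt_of_mul_lt_mul_right h1 (Nat.zero_le k)
    omega
  refine ⟨Coloring.mk (fun v => if v ∈ s then 0 else 1) ?_⟩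
  intro u w hadj
  have := hs u
  have := hcompl u
  grind

open Finset Classical in
/-- The spheres of radius less than half the girth in a regular graph of degree `q + 1`. -/
theorem Connected.le_card_sphere [Fintype V] {q : ℕ} (hc : G.Connected)
    (hreg : G.IsRegularOfDegree (q + 1)) (x : V) (r : ℕ)
    (hlt : ((2 * (r + 1) : ℕ) : ℕ∞) < G.egirth) :
    (q + 1) * q ^ r ≤ #{v | G.dist x v = r + 1} := by
  induction r with
  | zero =>
    rw [pow_zero, mul_one, ← hreg x, ← card_neighborFinset_eq_degree]
    refine card_le_card fun v hv => ?_
    simpa using hv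
  | succ r ih =>
    have ih := ih (lt_of_le_of_lt (by gcongr; omega) hlt)
    have := card_mul_le_card_mul (s := ({v | G.dist x v = r + 1} : Finset V))
      (t := ({v | G.dist x v = r + 1 + 1} : Finset V)) G.Adj (m := q) (n := 1) ?_ ?_
    · rw [pow_succ, ← mul_assoc]
      calc _ ≤ _ := Nat.mul_le_mul_right q ih
        _ ≤ _ := this
        _ = _ := mul_one _
    · intro a ha
      simp only [mem_filter, mem_univ, true_and] at ha
      have hdown : #{b ∈ G.neighborFinset a | G.dist x b = r} ≤ 1 := by
        refine card_le_one.2 fun u hu w hw => ?_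
        simp only [mem_filter, mem_neighborFinset] at hu hw
        refine hc.eq_of_adj_of_dist_eq (x := x) hu.1.symm hw.1.symm (by omega) (by omega)
          (lt_of_le_of_lt ?_ hlt)
        rw [ha]
        gcongr
        omega
      have hcover : G.neighborFinset a ⊆ {b ∈ G.neighborFinset a | G.dist x b = r} ∪
          bipartiteAbove G.Adj {v | G.dist x v = r + 1 + 1} a := by
        intro b hb
        rw [mem_neighborFinset] at hb
        have h1 : G.dist x a ≠ G.dist x b := hc.dist_ne_of_adj hb (lt_of_le_of_lt (by
          rw [ha]
          gcongr
          omega) hlt)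
        have h2 := hb.diff_dist_adj (u := x)
        simp only [mem_union, mem_filter, mem_neighborFinset, bipartiteAbove, mem_univ, true_and]
        have : G.dist x b = r ∨ G.dist x b = r + 1 + 1 := by omega
        tauto
      have h1 := (card_le_card hcover).trans (card_union_le _ _)
      rw [card_neighborFinset_eq_degree, hreg a] at h1
      omega
    · intro b hb
      simp only [mem_filter, mem_univ, true_and] at hb
      refine card_le_one.2 fun u hu w hw => ?_
      simp only [bipartiteBelow, mem_filter, mem_univ, true_and] at hu hw
      refine hc.eq_of_adj_of_dist_eq (x := x) hu.2 hw.2 (by omega) (by omega) ?_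
      rw [hb]
      exact hlt

/-- The vertices of the ball of radius `r` around `x` whose distance from `x` has the same
parity as `r`. -/
def parityBall (G : SimpleGraph V) (x : V) (r : ℕ) : Set V :=
  {v | G.dist x v ≤ r ∧ G.dist x v % 2 = r % 2}

theorem mem_parityBall {x v : V} {r : ℕ} :
    v ∈ G.parityBall x r ↔ G.dist x v ≤ r ∧ G.dist x v % 2 = r % 2 := Iff.rfl

theorem Connected.not_adj_of_mem_parityBall (hc : G.Connected) {x : V} {r : ℕ}
    (hlt : ((2 * r + 1 : ℕ) : ℕ∞) < G.egirth) {u w : V} (hu : u ∈ G.parityBall x r)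
    (hw : w ∈ G.parityBall x r) : ¬ G.Adj u w := by
  intro hadj
  obtain ⟨hu1, hu2⟩ := hu
  obtain ⟨hw1, hw2⟩ := hw
  have h1 : G.dist x u ≠ G.dist x w :=
    hc.dist_ne_of_adj hadj (lt_of_le_of_lt (by gcongr) hlt)
  have h2 := hadj.diff_dist_adj (u := x)
  omega

open Finset Classical in
theorem Connected.le_card_parityBall [Fintype V] {q : ℕ} (hc : G.Connected)
    (hreg : G.IsRegularOfDegree (q + 1)) (x : V) (r : ℕ)
    (hlt : ((2 * r : ℕ) : ℕ∞) < G.egirth) :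
    ∑ i ∈ range (r + 1), q ^ i ≤ #{v | v ∈ G.parityBall x r} := by
  induction r using Nat.twoStepInduction with
  | zero =>
    have : 0 < #{v | v ∈ G.parityBall x 0} := card_pos.2 ⟨x, by simp [parityBall]⟩
    simpa using this
  | one =>
    have h := hc.le_card_sphere hreg x 0 (by simpa using hlt)
    have h' : #{v | G.dist x v = 0 + 1} ≤ #{v | v ∈ G.parityBall x 1} := by
      refine card_le_card fun v hv => ?_
      simp only [mem_filter, mem_univ, true_and, mem_parityBall] at hv ⊢
      omega
    simp only [sum_range_succ, sum_range_zero, pow_zero, pow_one] at h ⊢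
    omega
  | more r ih _ =>
    have ih := ih (lt_of_le_of_lt (by gcongr; omega) hlt)
    have h := hc.le_card_sphere hreg x (r + 1) hlt
    have hdisj : Disjoint ({v | v ∈ G.parityBall x r} : Finset V)
        ({v | G.dist x v = r + 1 + 1} : Finset V) := by
      refine Finset.disjoint_left.2 fun v hv hv' => ?_
      simp only [mem_filter, mem_univ, true_and, mem_parityBall] at hv hv'
      omega
    have h' := card_le_card (s := ({v | v ∈ G.parityBall x r} : Finset V) ∪
      ({v | G.dist x v = r + 1 + 1} : Finset V))
      (t := ({v | v ∈ G.parityBall x (r + 2)} : Finset V)) (by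
        intro v hv
        simp only [mem_union, mem_filter, mem_univ, true_and, mem_parityBall] at hv ⊢
        omega)
    rw [card_union_of_disjoint hdisj] at h'
    rw [sum_range_succ, sum_range_succ]
    have hpow : (q + 1) * q ^ (r + 1) = q ^ (r + 1) + q ^ (r + 2) := by ring
    omega

end SimpleGraph

theorem mooreBound_even (q t : ℕ) :
    mooreBound (q + 1) ((2 * t : ℕ) : ℤ) = 2 * ∑ i ∈ Finset.range t, q ^ i := by
  rcases Nat.eq_zero_or_pos t with rfl | ht
  · simp [mooreBound]
  · have h1 : ¬ ((2 * t : ℕ) : ℤ) ≤ 0 := by omega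
    have h2 : ¬ ((2 * t : ℕ) : ℤ) % 2 = 1 := by omega
    have h3 : (((2 * t : ℕ) : ℤ) / 2).toNat = t := by omega
    rw [mooreBound, if_neg h1, if_neg h2, h3, Nat.add_sub_cancel]

theorem mooreBound0_le (q τ : ℕ) :
    mooreBound0 (q + 1) (2 * τ + 1) ≤ ∑ i ∈ Finset.range (τ + 1), q ^ i := by
  have key : ∀ n : ℕ, 1 + (q + 1) * ∑ i ∈ Finset.range n, q ^ (2 * i + 1) =
      ∑ i ∈ Finset.range (2 * n + 1), q ^ i := by
    intro n
    induction n with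
    | zero => simp
    | succ n ih =>
      rw [Finset.sum_range_succ, mul_add, ← add_assoc, ih,
        show 2 * (n + 1) + 1 = 2 * n + 1 + 1 + 1 by ring, Finset.sum_range_succ _ (2 * n + 1 + 1),
        Finset.sum_range_succ _ (2 * n + 1)]
      ring
  have h1 : ¬ (2 * (τ : ℤ) + 1) ≤ 0 := by omega
  have h3 : ((2 * (τ : ℤ) + 1 - 1) / 2 - 2) / 2 + 1 = ((τ / 2 : ℕ) : ℤ) := by omega
  rw [mooreBound0, if_neg h1, h3, Int.toNat_natCast, Nat.add_sub_cancel, key]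
  exact Finset.sum_le_sum_of_subset (Finset.range_mono (by omega))

theorem mooreBound1_le (q τ : ℕ) :
    mooreBound1 (q + 1) (2 * τ + 1) ≤ ∑ i ∈ Finset.range (τ + 1), q ^ i := by
  have key : ∀ n : ℕ, (q + 1) * ∑ i ∈ Finset.range n, q ^ (2 * i) =
      ∑ i ∈ Finset.range (2 * n), q ^ i := by
    intro n
    induction n with
    | zero => simp
    | succ n ih =>
      rw [Finset.sum_range_succ, mul_add, ih,
        show 2 * (n + 1) = 2 * n + 1 + 1 by ring, Finset.sum_range_succ _ (2 * n + 1),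
        Finset.sum_range_succ _ (2 * n)]
      ring
  have h1 : ¬ (2 * (τ : ℤ) + 1) ≤ 0 := by omega
  have h3 : ((2 * (τ : ℤ) + 1 - 1) / 2 - 1) / 2 + 1 = (((τ + 1) / 2 : ℕ) : ℤ) := by omega
  rw [mooreBound1, if_neg h1, h3, Int.toNat_natCast, Nat.add_sub_cancel, key]
  exact Finset.sum_le_sum_of_subset (Finset.range_mono (by omega))

theorem improved_moore_bound_attained_implies_bipartite (k g d t : ℕ) (hk : 3 ≤ k)
    (ht : g = 2 * t) (hg : 4 ≤ g) (hd1 : t ≤ d) (hd2 : d ≤ g)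
    {V : Type*} [Fintype V] (G : SimpleGraph V) (hG : IsKGDGraph k g d G)
    (hcard : Fintype.card V = mooreBound k g +
      2 * max (mooreBound0 k (2 * (d : ℤ) - 2 * t - 1))
        (mooreBound1 k (2 * (d : ℤ) - 2 * t - 1))) :
    G.Colorable 2 := by
  classical
  obtain ⟨hreg', hgirth, hdiam⟩ := hG
  obtain ⟨q, rfl⟩ : ∃ q, k = q + 1 := ⟨k - 1, by omega⟩
  obtain ⟨s, rfl⟩ : ∃ s, t = s + 1 := ⟨t - 1, by omega⟩
  subst ht
  have hreg : G.IsRegularOfDegree (q + 1) := fun v => by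
    rw [← hreg' v, ← SimpleGraph.card_neighborSet_eq_degree, Set.ncard_eq_toFinset_card',
      Set.toFinset_card]
  have hgt : ∀ n : ℕ, n < 2 * (s + 1) → (n : ℕ∞) < G.egirth := fun n hn => by
    rw [hgirth]
    exact_mod_cast hn
  have hnt : Nontrivial V := SimpleGraph.nontrivial_of_ediam_ne_zero (G := G) (by
    rw [hdiam]
    exact_mod_cast (by omega : d ≠ 0))
  have htop : G.ediam ≠ ⊤ := by simp [hdiam]
  have hc := SimpleGraph.connected_of_ediam_ne_top htop
  obtain ⟨x, y, hxy⟩ := SimpleGraph.exists_edist_eq_ediam_of_ne_top htop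
  have hd : G.dist x y = d := by
    rw [SimpleGraph.dist, hxy, hdiam, ENat.toNat_natCast]
  rw [mooreBound_even] at hcard
  have hx := hc.le_card_parityBall hreg x s (hgt _ (by omega))
  rcases Nat.lt_or_ge (s + 1) d with hlt | hge
  · obtain ⟨τ, rfl⟩ : ∃ τ, d = s + 1 + τ + 1 := ⟨d - s - 2, by omega⟩
    have hy := hc.le_card_parityBall hreg y τ (hgt _ (by omega))
    have hm : 2 * ((s + 1 + τ + 1 : ℕ) : ℤ) - 2 * ((s + 1 : ℕ) : ℤ) - 1 = 2 * (τ : ℤ) + 1 := by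
      push_cast
      ring
    rw [hm] at hcard
    have hmax := max_le (mooreBound0_le q τ) (mooreBound1_le q τ)
    have hfar : ∀ u ∈ G.parityBall x s, ∀ w ∈ G.parityBall y τ, 2 ≤ G.dist u w := by
      intro u hu w hw
      have h1 := hc.dist_triangle (u := x) (v := u) (w := y)
      have h2 := hc.dist_triangle (u := u) (v := w) (w := y)
      rw [SimpleGraph.dist_comm (u := w) (v := y)] at h2
      have h3 := hu.1
      have h4 := hw.1
      omega
    have hdisj : Disjoint ({v | v ∈ G.parityBall x s} : Finset V)
        ({v | v ∈ G.parityBall y τ} : Finset V) := by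
      refine Finset.disjoint_left.2 fun v hv hv' => ?_
      have := hfar v (by simpa using hv) v (by simpa using hv')
      simp at this
    refine SimpleGraph.colorable_two_of_isIndepSet hreg
      (({v | v ∈ G.parityBall x s} : Finset V) ∪ ({v | v ∈ G.parityBall y τ} : Finset V)) ?_ ?_
    · intro u hu w hw hadj
      simp only [Finset.mem_union, Finset.mem_filter, Finset.mem_univ, true_and] at hu hw
      rcases hu with hu | hu <;> rcases hw with hw | hw
      · exact hc.not_adj_of_mem_parityBall (hgt _ (by omega)) hu hw hadj
      · have := hfar u hu w hw
        rw [SimpleGraph.dist_eq_one_iff_adj.2 hadj] at this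
        omega
      · have := hfar w hw u hu
        rw [SimpleGraph.dist_eq_one_iff_adj.2 hadj.symm] at this
        omega
      · exact hc.not_adj_of_mem_parityBall (hgt _ (by omega)) hu hw hadj
    · rw [Finset.card_union_of_disjoint hdisj]
      omega
  · have hm : 2 * (d : ℤ) - 2 * ((s + 1 : ℕ) : ℤ) - 1 ≤ 0 := by omega
    rw [mooreBound0, mooreBound1, if_pos hm, if_pos hm] at hcard
    refine SimpleGraph.colorable_two_of_isIndepSet hreg
      ({v | v ∈ G.parityBall x s} : Finset V) ?_ ?_
    · intro u hu w hw
      exact hc.not_adj_of_mem_parityBall (x := x) (r := s) (hgt _ (by omega)) (by simpa using hu)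
        (by simpa using hw)
    · omega
end

section
/- Let k ≥ 3 and g ≥ 3 be integers, let G be a finite connected k-regular simple graph with girth at least g, let u be a vertex of G, and for each i let N_i(u) denote the set of vertices at distance exactly i from u. If j and q are integers with 1 ≤ j ≤ g, q ≥ 0, and N_{q+j}(u) is nonempty, then |N_{q+1}(u)| + |N_{q+2}(u)| + … + |N_{q+j}(u)| ≥ M(k,j). -/
namespace SimpleGraph

open Finset

variable {V : Type*} {G : SimpleGraph V}

theorem Connected.exists_adj_dist_eq (hconn : G.Connected) {w x : V} {n : ℕ}
    (h : G.dist w x = n + 1) : ∃ z, G.Adj x z ∧ G.dist w z = n := by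
  obtain ⟨p, hp⟩ := hconn.exists_walk_length_eq_dist x w
  rw [G.dist_comm, h] at hp
  cases p with
  | nil => simp at hp
  | @cons _ z _ hxz p =>
    refine ⟨z, hxz, ?_⟩
    have hle := dist_le p
    have htri := hconn.dist_triangle (u := w) (v := z) (w := x)
    have hzx := dist_eq_one_iff_adj.mpr hxz.symm
    rw [G.dist_comm] at hle
    simp only [Walk.length_cons] at hp
    omega

theorem Connected.exists_dist_eq_of_le (hconn : G.Connected) {u v : V} {m : ℕ}
    (h : m ≤ G.dist u v) : ∃ w, G.dist u w = m := by
  obtain ⟨d, hd⟩ := Nat.exists_eq_add_of_le h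
  clear h
  induction d generalizing v with
  | zero => exact ⟨v, hd⟩
  | succ d ih =>
    obtain ⟨z, -, hz⟩ := hconn.exists_adj_dist_eq (n := m + d) hd
    exact ih hz

/-- Two distinct neighbours of `x` that are no farther from `w` than `x` is yield a short cycle. -/
theorem Connected.egirth_le_dist_add_dist (hconn : G.Connected) {w x y z : V}
    (hxy : G.Adj x y) (hxz : G.Adj x z) (hyz : y ≠ z)
    (hy : G.dist w y ≤ G.dist w x) (hz : G.dist w z ≤ G.dist w x) :
    G.egirth ≤ (G.dist w y + G.dist w z + 2 : ℕ) := by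
  classical
  have key : ∀ y, G.Adj x y → G.dist w y ≤ G.dist w x →
      ∃ (h : G.Adj x y) (p : G.Walk y w), p.length = G.dist w y ∧ (Walk.cons h p).IsPath := by
    intro y hxy hy
    obtain ⟨p, hp, hpl⟩ := hconn.exists_path_of_dist y w
    refine ⟨hxy, p, by rw [hpl, G.dist_comm], ?_⟩
    rw [Walk.cons_isPath_iff]
    refine ⟨hp, fun hx => ?_⟩
    have h1 := dist_le (p.dropUntil x hx)
    have h2 := Walk.length_dropUntil_lt_length hx hxy.ne
    rw [G.dist_comm] at h1 hpl
    omega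
  obtain ⟨h1, p, hp, hpp⟩ := key y hxy hy
  obtain ⟨h2, r, hr, hrp⟩ := key z hxz hz
  have hne : Walk.cons h1 p ≠ Walk.cons h2 r := by
    intro h
    injection h with _ h
    exact hyz h
  obtain ⟨_, -, -, c, hc, hcl⟩ := hpp.exists_isCycle_length_le_add_of_ne hrp hne
  refine (egirth_le_length hc).trans ?_
  simp only [Walk.length_cons] at hcl
  exact_mod_cast (by omega : c.length ≤ G.dist w y + G.dist w z + 2)

theorem Connected.eq_of_adj_of_dist_le (hconn : G.Connected) {w x y z : V}
    (hgirth : ((2 * G.dist w x + 2 : ℕ) : ℕ∞) ≤ G.egirth)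
    (hxy : G.Adj x y) (hxz : G.Adj x z)
    (hy : G.dist w y ≤ G.dist w x) (hz : G.dist w z ≤ G.dist w x) : y = z := by
  rcases h : G.dist w x with _ | n
  · have hy0 : G.dist w y = 0 := by omega
    rw [hconn.dist_eq_zero_iff] at h hy0
    exact absurd (h.symm.trans hy0) hxy.ne
  obtain ⟨p, hxp, hp⟩ := hconn.exists_adj_dist_eq h
  have key : ∀ y, G.Adj x y → G.dist w y ≤ G.dist w x → y = p := by
    intro y hxy hy
    by_contra hne
    have := hgirth.trans (hconn.egirth_le_dist_add_dist hxy hxp hne hy (by omega))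
    have := Nat.cast_le.mp this
    omega
  rw [key y hxy hy, key z hxz hz]

variable [Fintype V]

open Classical in
theorem Connected.le_card_adj_dist_succ (hconn : G.Connected) {k : ℕ}
    (hreg : ∀ v : V, (G.neighborSet v).ncard = k) {w x : V}
    (hgirth : ((2 * G.dist w x + 2 : ℕ) : ℕ∞) ≤ G.egirth) :
    k - 1 ≤ #{y | G.Adj x y ∧ G.dist w y = G.dist w x + 1} := by
  have hdeg : #{y | G.Adj x y} = k := by
    rw [← hreg x, ← Set.ncard_coe_finset]
    congr 1
    ext
    simp
  rw [← hdeg, ← card_filter_add_card_filter_not (s := {y | G.Adj x y})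
    (fun y => G.dist w y = G.dist w x + 1), filter_filter, filter_filter]
  have : #{y | G.Adj x y ∧ ¬ G.dist w y = G.dist w x + 1} ≤ 1 := by
    have hle : ∀ y, G.Adj x y → ¬ G.dist w y = G.dist w x + 1 → G.dist w y ≤ G.dist w x := by
      intro y hxy hne
      rcases hxy.diff_dist_adj (u := w) with h | h | h <;> omega
    rw [card_le_one]
    simp only [mem_filter, mem_univ, true_and]
    intro a ha b hb
    exact hconn.eq_of_adj_of_dist_le hgirth ha.1 hb.1 (hle a ha.1 ha.2) (hle b hb.1 hb.2)
  omega

variable (G) in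
open Classical in
/-- The vertices at distance `i` from `w'` and `i + 1` from `w`. -/
noncomputable def branch (w w' : V) (i : ℕ) : Finset V :=
  {x | G.dist w x = i + 1 ∧ G.dist w' x = i}

theorem mem_branch {w w' x : V} {i : ℕ} :
    x ∈ G.branch w w' i ↔ G.dist w x = i + 1 ∧ G.dist w' x = i := by
  simp [branch]

open Classical in
theorem Connected.pow_le_card_branch (hconn : G.Connected) {k : ℕ}
    (hreg : ∀ v : V, (G.neighborSet v).ncard = k) {w w' : V} (hadj : G.Adj w w') (i : ℕ)
    (hgirth : ((2 * i + 2 : ℕ) : ℕ∞) ≤ G.egirth) :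
    (k - 1) ^ i ≤ #(G.branch w w' i) := by
  induction i with
  | zero =>
    rw [pow_zero, Nat.one_le_iff_ne_zero, card_ne_zero]
    exact ⟨w', mem_branch.mpr ⟨dist_eq_one_iff_adj.mpr hadj, dist_self⟩⟩
  | succ i ih =>
    have ih := ih (le_trans (by exact_mod_cast (by omega : 2 * i + 2 ≤ 2 * (i + 1) + 2)) hgirth)
    have hstep : #(G.branch w w' i) * (k - 1) ≤ #(G.branch w w' (i + 1)) * 1 := by
      apply card_mul_le_card_mul G.Adj
      · intro x hx
        rw [mem_branch] at hx
        refine (hconn.le_card_adj_dist_succ hreg (w := w) (x := x) ?_).trans (card_le_card ?_)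
        · rw [hx.1]
          exact hgirth
        · intro y hy
          simp only [mem_filter, mem_univ, true_and] at hy
          rw [mem_bipartiteAbove, mem_branch]
          have htri := hconn.dist_triangle (u := w) (v := w') (w := y)
          have hww' := dist_eq_one_iff_adj.mpr hadj
          rcases hy.1.diff_dist_adj (u := w') with h | h | h <;>
            exact ⟨⟨by omega, by omega⟩, hy.1⟩
      · intro y hy
        rw [mem_branch] at hy
        rw [card_le_one]
        intro a ha b hb
        rw [mem_bipartiteBelow, mem_branch] at ha hb
        refine hconn.eq_of_adj_of_dist_le (w := w') ?_ ha.2.symm hb.2.symm (by omega) (by omega)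
        rw [hy.2]
        exact hgirth
    calc (k - 1) ^ (i + 1) = (k - 1) ^ i * (k - 1) := pow_succ ..
      _ ≤ #(G.branch w w' i) * (k - 1) := Nat.mul_le_mul_right _ ih
      _ ≤ _ := by simpa using hstep

open Classical in
theorem Connected.mul_pow_le_card_sphere (hconn : G.Connected) {k : ℕ}
    (hreg : ∀ v : V, (G.neighborSet v).ncard = k) (w : V) (i : ℕ)
    (hgirth : ((2 * i + 3 : ℕ) : ℕ∞) ≤ G.egirth) :
    k * (k - 1) ^ i ≤ #{x | G.dist w x = i + 1} := by
  have hdeg : #{y | G.Adj w y} = k := by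
    rw [← hreg w, ← Set.ncard_coe_finset]
    congr 1
    ext
    simp
  have hdisj : ∀ a ∈ ({y | G.Adj w y} : Finset V), ∀ b ∈ ({y | G.Adj w y} : Finset V), a ≠ b →
      Disjoint (G.branch w a i) (G.branch w b i) := by
    intro a ha b hb hab
    simp only [mem_filter, mem_univ, true_and] at ha hb
    rw [Finset.disjoint_left]
    intro x hxa hxb
    rw [mem_branch, G.dist_comm, G.dist_comm (u := a)] at hxa
    rw [mem_branch, G.dist_comm, G.dist_comm (u := b)] at hxb
    have := hgirth.trans
      (hconn.egirth_le_dist_add_dist (w := x) ha hb hab (by omega) (by omega))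
    have := Nat.cast_le.mp this
    omega
  calc k * (k - 1) ^ i = ∑ y with G.Adj w y, (k - 1) ^ i := by
        rw [sum_const, hdeg, smul_eq_mul]
    _ ≤ ∑ y with G.Adj w y, #(G.branch w y i) := by
        refine sum_le_sum fun y hy => hconn.pow_le_card_branch hreg (by simpa using hy) i
          (le_trans (by exact_mod_cast (by omega : 2 * i + 2 ≤ 2 * i + 3)) hgirth)
    _ = #(({y | G.Adj w y} : Finset V).biUnion fun y => G.branch w y i) :=
        (card_biUnion hdisj).symm
    _ ≤ _ := by
        refine card_le_card fun x hx => ?_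
        simp only [mem_biUnion, mem_branch, mem_filter, mem_univ, true_and] at hx ⊢
        obtain ⟨_, -, h, -⟩ := hx
        exact h

open Classical in
theorem Connected.moore_le_card_ball (hconn : G.Connected) {k : ℕ}
    (hreg : ∀ v : V, (G.neighborSet v).ncard = k) (w : V) (t : ℕ)
    (hgirth : ((2 * t + 1 : ℕ) : ℕ∞) ≤ G.egirth) :
    1 + k * ∑ i ∈ range t, (k - 1) ^ i ≤ #{x | G.dist w x ≤ t} := by
  rw [card_eq_sum_card_fiberwise (f := fun x => G.dist w x) (t := range (t + 1))
    (fun x hx => by simpa [Nat.lt_succ_iff] using hx), sum_range_succ', add_comm, mul_sum]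
  refine add_le_add (sum_le_sum fun i hi => ?_) ?_
  · rw [mem_range] at hi
    refine (hconn.mul_pow_le_card_sphere hreg w i
      (le_trans (by exact_mod_cast (by omega : 2 * i + 3 ≤ 2 * t + 1)) hgirth)).trans
      (card_le_card fun x hx => ?_)
    simp only [mem_filter, mem_univ, true_and] at hx ⊢
    omega
  · rw [Nat.one_le_iff_ne_zero, card_ne_zero]
    exact ⟨w, by simp⟩

open Classical in
theorem Connected.moore_le_card_edge_ball (hconn : G.Connected) {k : ℕ}
    (hreg : ∀ v : V, (G.neighborSet v).ncard = k) {w w' : V} (hadj : G.Adj w w') (t : ℕ)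
    (hgirth : ((2 * t : ℕ) : ℕ∞) ≤ G.egirth) :
    2 * ∑ i ∈ range t, (k - 1) ^ i ≤ #{x | G.dist w x < t ∨ G.dist w' x < t} := by
  have half : ∀ {a b : V}, G.Adj a b →
      ∑ i ∈ range t, (k - 1) ^ i ≤ #{x | G.dist a x = G.dist b x + 1 ∧ G.dist b x < t} := by
    intro a b hab
    rw [card_eq_sum_card_fiberwise (f := fun x => G.dist b x) (t := range t)
      (fun x hx => by
        simp only [coe_filter, mem_univ, true_and, Set.mem_ofPred_eq] at hx
        simpa using hx.2)]
    refine sum_le_sum fun i hi => ?_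
    rw [mem_range] at hi
    refine (hconn.pow_le_card_branch hreg hab i
      (le_trans (by exact_mod_cast (by omega : 2 * i + 2 ≤ 2 * t)) hgirth)).trans
      (card_le_card fun x hx => ?_)
    rw [mem_branch] at hx
    simp only [mem_filter, mem_univ, true_and]
    omega
  rw [two_mul]
  refine (add_le_add (half hadj) (half hadj.symm)).trans ?_
  rw [← card_union_of_disjoint]
  · refine card_le_card fun x hx => ?_
    simp only [mem_union, mem_filter, mem_univ, true_and] at hx ⊢
    omega
  · rw [Finset.disjoint_left]
    intro x hx hx'
    simp only [mem_filter, mem_univ, true_and] at hx hx'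
    omega

open Classical in
theorem sum_ncard_sphere (u : V) (q j : ℕ) :
    ∑ i ∈ Icc 1 j, {v : V | G.dist u v = q + i}.ncard
      = #{v | q + 1 ≤ G.dist u v ∧ G.dist u v ≤ q + j} := by
  rw [card_eq_sum_card_fiberwise (f := fun x => G.dist u x - q) (t := Icc 1 j)
    (fun x hx => by
      simp only [coe_filter, mem_univ, true_and, Set.mem_ofPred_eq] at hx
      simp only [coe_Icc, Set.mem_Icc]
      omega)]
  refine sum_congr rfl fun i hi => ?_
  rw [mem_Icc] at hi
  rw [← Set.ncard_coe_finset]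
  congr 1
  ext x
  simp only [Set.mem_ofPred_eq, coe_filter, mem_filter, mem_univ, true_and]
  omega

end SimpleGraph

theorem consecutive_neighbourhoods_moore_bound (k g j q : ℕ) (hk : 3 ≤ k) (hg : 3 ≤ g)
    {V : Type*} [Fintype V] (G : SimpleGraph V) (hconn : G.Connected)
    (hreg : IsRegular' k G) (hgirth : (g : ℕ∞) ≤ G.egirth) (u : V)
    (hj1 : 1 ≤ j) (hj2 : j ≤ g)
    (hne : {v : V | G.dist u v = q + j}.Nonempty) :
    mooreBound k j ≤ ∑ i ∈ Finset.Icc 1 j, {v : V | G.dist u v = q + i}.ncard := by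
  classical
  obtain ⟨v, hv⟩ := hne
  rw [Set.mem_ofPred_eq] at hv
  rw [SimpleGraph.sum_ncard_sphere]
  have hjg : (j : ℕ∞) ≤ G.egirth := le_trans (by exact_mod_cast hj2) hgirth
  obtain ⟨t, rfl | rfl⟩ := Nat.even_or_odd' j
  · obtain ⟨w', hw'⟩ := hconn.exists_dist_eq_of_le (u := u) (v := v) (m := q + t + 1) (by omega)
    obtain ⟨w, hadj, hw⟩ := hconn.exists_adj_dist_eq hw'
    have hM : mooreBound k ((2 * t : ℕ) : ℤ) = 2 * ∑ i ∈ Finset.range t, (k - 1) ^ i := by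
      unfold mooreBound
      rw [if_neg (by omega), if_neg (by omega)]
      congr 3
      omega
    rw [hM]
    refine (hconn.moore_le_card_edge_ball hreg hadj.symm t hjg).trans
      (Finset.card_le_card fun x hx => ?_)
    simp only [Finset.mem_filter, Finset.mem_univ, true_and] at hx ⊢
    have h1 := hconn.dist_triangle (u := u) (v := w) (w := x)
    have h2 := hconn.dist_triangle (u := u) (v := w') (w := x)
    have h3 := hconn.dist_triangle (u := u) (v := x) (w := w)
    have h4 := hconn.dist_triangle (u := u) (v := x) (w := w')
    rw [G.dist_comm (u := x)] at h3 h4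
    omega
  · obtain ⟨w, hw⟩ := hconn.exists_dist_eq_of_le (u := u) (v := v) (m := q + t + 1) (by omega)
    have hM : mooreBound k ((2 * t + 1 : ℕ) : ℤ)
        = 1 + k * ∑ i ∈ Finset.range t, (k - 1) ^ i := by
      unfold mooreBound
      rw [if_neg (by omega), if_pos (by omega)]
      congr 4
      omega
    rw [hM]
    refine (hconn.moore_le_card_ball hreg w t hjg).trans (Finset.card_le_card fun x hx => ?_)
    simp only [Finset.mem_filter, Finset.mem_univ, true_and] at hx ⊢
    have h1 := hconn.dist_triangle (u := u) (v := w) (w := x)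
    have h3 := hconn.dist_triangle (u := u) (v := x) (w := w)
    rw [G.dist_comm (u := x)] at h3
    omega
end
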